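/- Let K be a field, S = K[x_1,…,x_n], let I ⊆ S be the ideal generated by the variable x_1 together with a nonempty set E of squarefree monomials of degree 2 in the variables x_2,…,x_n, and let J ⊂ I be a squarefree monomial ideal generated in degrees ≥ 2. Let B (resp. C) be the set of squarefree monomials of degree 2 (resp. 3) in I \ J, let E' = {a ∈ E : x_1·a ∈ C} and E'' = E \ E'. Assume sdepth_S I/J = 2, assume every squarefree monomial u ∈ S of degree 2 with u ∉ I satisfies x_1·u ∈ J, and assume one of the following holds: (1) |E''| ≤ |C \ ((x_1) ∪ (E'))|, or (2) |E''| > |C \ ((x_1) ∪ (E'))| and |B| ≠ |C| + 1. Then depth_S I/J ≤ 2. -/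

import Mathlib

open MvPolynomial

/-- The squarefree monomial with support `T` in `K[x_0,…,x_{n-1}]`. -/
noncomputable def sqf (K : Type*) [Field K] (n : ℕ) (T : Finset (Fin n)) :
    MvPolynomial (Fin n) K :=
  ∏ i ∈ T, X i

/-- The poset `P_{I\J}`: supports of squarefree monomials lying in `I \ J`. -/
def sqfPoset (K : Type*) [Field K] (n : ℕ) (I J : Ideal (MvPolynomial (Fin n) K)) :
    Set (Finset (Fin n)) :=
  {T | sqf K n T ∈ I ∧ sqf K n T ∉ J}

/-- Supports of squarefree monomials of degree `d` lying in `I \ J`. -/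
def degSet (K : Type*) [Field K] (n : ℕ) (I J : Ideal (MvPolynomial (Fin n) K)) (d : ℕ) :
    Set (Finset (Fin n)) :=
  {T | T.card = d ∧ T ∈ sqfPoset K n I J}

/-- A partition of a set `P` of supports of squarefree monomials into intervals
`[u,v] = {w : u ⊆ w ⊆ v}`. -/
structure SqfPartition (n : ℕ) (P : Set (Finset (Fin n))) where
  intervals : Finset (Finset (Fin n) × Finset (Fin n))
  le : ∀ p ∈ intervals, p.1 ⊆ p.2
  ends : ∀ p ∈ intervals, p.1 ∈ P ∧ p.2 ∈ P
  covers : ∀ T ∈ P, ∃ p ∈ intervals, p.1 ⊆ T ∧ T ⊆ p.2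
  disj : ∀ p ∈ intervals, ∀ q ∈ intervals, ∀ T : Finset (Fin n),
    p.1 ⊆ T → T ⊆ p.2 → q.1 ⊆ T → T ⊆ q.2 → p = q

/-- The Stanley depth of a partition: the minimal degree of the upper ends of
its intervals. -/
noncomputable def SqfPartition.sdepth {n : ℕ} {P : Set (Finset (Fin n))}
    (pt : SqfPartition n P) : ℕ :=
  sInf {k | ∃ p ∈ pt.intervals, p.2.card = k}

/-- The Stanley depth of `I/J`: the maximal Stanley depth of a partition of `P_{I\J}`. -/
noncomputable def stanleyDepth (K : Type*) [Field K] (n : ℕ)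
    (I J : Ideal (MvPolynomial (Fin n) K)) : ℕ :=
  sSup {k | ∃ pt : SqfPartition n (sqfPoset K n I J), pt.sdepth = k}

/-- The `S`-module `I/J` (for `J ⊆ I` this is the usual quotient). -/
noncomputable abbrev quotMod (K : Type*) [Field K] (n : ℕ)
    (I J : Ideal (MvPolynomial (Fin n) K)) : Type _ :=
  I ⧸ (Submodule.comap I.subtype J)

/-- The depth of `I/J` over `S = K[x_0,…,x_{n-1}]`: the supremum of lengths of
regular sequences on `I/J` consisting of elements of the maximal graded ideal
`(x_0,…,x_{n-1})`. -/
noncomputable def mdepth (K : Type*) [Field K] (n : ℕ)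
    (I J : Ideal (MvPolynomial (Fin n) K)) : ℕ :=
  sSup {k | ∃ rs : List (MvPolynomial (Fin n) K), rs.length = k ∧
    (∀ r ∈ rs, r ∈ Ideal.span (Set.range (X : Fin n → MvPolynomial (Fin n) K))) ∧
    RingTheory.Sequence.IsRegular (quotMod K n I J) rs}


/-- Elements killed by all `x i` vanish if some combination of the `x i` is regular. -/
theorem eq_zero_of_forall_smul_eq_zero {R M ι : Type*} [CommRing R] [AddCommGroup M] [Module R M]
    [Fintype ι] (x : ι → R) {r : R} (hr : r ∈ Ideal.span (Set.range x))
    (hreg : IsSMulRegular M r) (m : M) (hm : ∀ i, x i • m = 0) : m = 0 := by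
  obtain ⟨a, rfl⟩ := (Ideal.mem_span_range_iff_exists_fun).1 hr
  apply hreg
  simp [Finset.sum_smul, mul_smul, hm]

theorem quotSMulTop_mk_eq_zero {R M : Type*} [CommRing R] [AddCommGroup M] [Module R M]
    {r : R} {m : M} :
    (Submodule.Quotient.mk m : QuotSMulTop r M) = 0 ↔ ∃ m', m = r • m' := by
  rw [Submodule.Quotient.mk_eq_zero, Submodule.mem_smul_pointwise_iff_exists]
  constructor
  · rintro ⟨b, -, hb⟩
    exact ⟨b, hb.symm⟩
  · rintro ⟨b, hb⟩
    exact ⟨b, trivial, hb.symm⟩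

/-- Vanishing of the first Koszul cohomology of a module of depth at least two. -/
theorem exists_eq_smul_of_koszul_cocycle {R M ι : Type*} [CommRing R] [AddCommGroup M]
    [Module R M] [Fintype ι] (x : ι → R) {r s : R} (hr : r ∈ Ideal.span (Set.range x))
    (hs : s ∈ Ideal.span (Set.range x)) (hreg : IsSMulRegular M r)
    (hreg' : IsSMulRegular (QuotSMulTop r M) s)
    (m : ι → M) (hm : ∀ i j, x i • m j = x j • m i) : ∃ m', ∀ i, m i = x i • m' := by
  obtain ⟨a, ha⟩ := (Ideal.mem_span_range_iff_exists_fun).1 hr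
  have key : ∀ i, x i • ∑ j, a j • m j = r • m i := by
    intro i
    rw [← ha, Finset.smul_sum, Finset.sum_smul]
    refine Finset.sum_congr rfl fun j _ ↦ ?_
    rw [smul_comm, hm, mul_smul]
  have h0 := eq_zero_of_forall_smul_eq_zero x hs hreg'
    (Submodule.Quotient.mk (∑ j, a j • m j)) fun i ↦ by
      rw [← Submodule.Quotient.mk_smul, quotSMulTop_mk_eq_zero]
      exact ⟨m i, key i⟩
  obtain ⟨m', hm'⟩ := quotSMulTop_mk_eq_zero.1 h0
  refine ⟨m', fun i ↦ hreg ?_⟩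
  show r • m i = r • x i • m'
  rw [← key, hm', smul_comm]

/-- Vanishing of the second Koszul cohomology of a module of depth at least three. -/
theorem exists_eq_smul_sub_smul_of_koszul_cocycle {R M ι : Type*} [CommRing R] [AddCommGroup M]
    [Module R M] [Fintype ι] (x : ι → R) {r s t : R} (hr : r ∈ Ideal.span (Set.range x))
    (hs : s ∈ Ideal.span (Set.range x)) (ht : t ∈ Ideal.span (Set.range x))
    (hreg : IsSMulRegular M r) (hreg' : IsSMulRegular (QuotSMulTop r M) s)
    (hreg'' : IsSMulRegular (QuotSMulTop s (QuotSMulTop r M)) t)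
    (m : ι → ι → M) (hanti : ∀ i j, m i j = - m j i)
    (hm : ∀ i j k, x i • m j k - x j • m i k + x k • m i j = 0) :
    ∃ m' : ι → M, ∀ i k, m i k = x i • m' k - x k • m' i := by
  obtain ⟨a, ha⟩ := (Ideal.mem_span_range_iff_exists_fun).1 hr
  have key : ∀ i k, x i • (∑ j, a j • m j k) - x k • (∑ j, a j • m j i) = r • m i k := by
    intro i k
    rw [← ha, Finset.smul_sum, Finset.smul_sum, Finset.sum_smul, ← Finset.sum_sub_distrib]
    refine Finset.sum_congr rfl fun j _ ↦ ?_
    rw [smul_comm (x i), smul_comm (x k), ← smul_sub, mul_smul]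
    congr 1
    have h := hm i j k
    rw [hanti i j] at h
    rw [← sub_eq_zero, ← h, smul_neg]
    abel
  obtain ⟨q, hq⟩ := exists_eq_smul_of_koszul_cocycle x hs ht hreg' hreg''
    (fun k ↦ Submodule.Quotient.mk (∑ j, a j • m j k)) fun i k ↦ by
      rw [← sub_eq_zero, ← Submodule.Quotient.mk_smul, ← Submodule.Quotient.mk_smul,
        ← Submodule.Quotient.mk_sub, quotSMulTop_mk_eq_zero]
      exact ⟨m i k, key i k⟩
  obtain ⟨q, rfl⟩ := Submodule.Quotient.mk_surjective _ q
  have h2 : ∀ k, ∃ c, (∑ j, a j • m j k) - x k • q = r • c := by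
    intro k
    rw [← quotSMulTop_mk_eq_zero, Submodule.Quotient.mk_sub, hq, Submodule.Quotient.mk_smul,
      sub_self]
  choose c hc using h2
  refine ⟨c, fun i k ↦ hreg ?_⟩
  show r • m i k = r • (x i • c k - x k • c i)
  rw [← key, smul_sub, smul_comm r, smul_comm r, ← hc, ← hc, smul_sub, smul_sub,
    smul_comm (x i) (x k) q]
  abel

theorem sqf_eq_monomial (K : Type*) [Field K] {n : ℕ} (T : Finset (Fin n)) :
    sqf K n T = monomial (∑ i ∈ T, Finsupp.single i 1) 1 := by
  rw [sqf]
  induction T using Finset.induction_on with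
  | empty => simp
  | insert a T ha ih => rw [Finset.prod_insert ha, Finset.sum_insert ha, ih, X, monomial_mul, one_mul]

theorem sum_single_one_apply {n : ℕ} (T : Finset (Fin n)) (i : Fin n) :
    (∑ j ∈ T, Finsupp.single j 1 : Fin n →₀ ℕ) i = if i ∈ T then 1 else 0 := by
  rw [Finsupp.finsetSum_apply]
  simp [Finsupp.single_apply]

theorem mem_span_sqf_iff {K : Type*} [Field K] {n : ℕ} {G : Set (Finset (Fin n))}
    {p : MvPolynomial (Fin n) K} :
    p ∈ Ideal.span (sqf K n '' G) ↔
      ∀ s ∈ p.support, ∃ T ∈ G, ∀ i ∈ T, s i ≠ 0 := by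
  have h : sqf K n '' G = (fun s ↦ monomial s (1 : K)) ''
      ((fun T : Finset (Fin n) ↦ (∑ i ∈ T, Finsupp.single i 1 : Fin n →₀ ℕ)) '' G) := by
    rw [Set.image_image]
    exact Set.image_congr fun T _ ↦ sqf_eq_monomial K T
  rw [h, mem_ideal_span_monomial_image]
  refine forall₂_congr fun s _ ↦ ?_
  rw [Set.exists_mem_image]
  refine exists_congr fun T ↦ and_congr_right fun _ ↦ ?_
  rw [Finsupp.le_def]
  refine forall_congr' fun i ↦ ?_
  rw [sum_single_one_apply]
  split_ifs with hi
  · simp [hi, Nat.one_le_iff_ne_zero]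
  · simp [hi]

theorem sqf_mem_span_iff {K : Type*} [Field K] {n : ℕ} {G : Set (Finset (Fin n))}
    {T : Finset (Fin n)} : sqf K n T ∈ Ideal.span (sqf K n '' G) ↔ ∃ U ∈ G, U ⊆ T := by
  classical
  rw [mem_span_sqf_iff, sqf_eq_monomial, support_monomial, if_neg one_ne_zero]
  simp [sum_single_one_apply, Finset.subset_iff]

theorem coeff_eq_zero_of_mem_span_sqf {K : Type*} [Field K] {n : ℕ} {G : Set (Finset (Fin n))}
    {p : MvPolynomial (Fin n) K} (hp : p ∈ Ideal.span (sqf K n '' G)) {T : Finset (Fin n)}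
    (hT : sqf K n T ∉ Ideal.span (sqf K n '' G)) :
    coeff (∑ i ∈ T, Finsupp.single i 1) p = 0 := by
  by_contra h
  obtain ⟨U, hU, hUT⟩ := mem_span_sqf_iff.1 hp _ (mem_support_iff.2 h)
  refine hT (sqf_mem_span_iff.2 ⟨U, hU, fun i hi ↦ ?_⟩)
  have := hUT i hi
  rw [sum_single_one_apply] at this
  by_contra hc
  simp [hc] at this

/-- A regular sequence of length three kills the second Koszul cohomology of `I/J`,
stated for representatives in `I`. -/
theorem exists_koszul_primitive {K : Type*} [Field K] {n : ℕ}
    {I J : Ideal (MvPolynomial (Fin n) K)} (h3 : 2 < mdepth K n I J)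
    (p : Fin n → Fin n → MvPolynomial (Fin n) K) (hpI : ∀ i j, p i j ∈ I)
    (hanti : ∀ i j, p i j = - p j i)
    (hp : ∀ i j k, X i * p j k - X j * p i k + X k * p i j ∈ J) :
    ∃ N : Fin n → MvPolynomial (Fin n) K, (∀ i, N i ∈ I) ∧
      ∀ i k, p i k - (X i * N k - X k * N i) ∈ J := by
  have hne : {k | ∃ rs : List (MvPolynomial (Fin n) K), rs.length = k ∧
      (∀ r ∈ rs, r ∈ Ideal.span (Set.range (X : Fin n → MvPolynomial (Fin n) K))) ∧
      RingTheory.Sequence.IsRegular (quotMod K n I J) rs}.Nonempty := by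
    by_contra h
    rw [Set.not_nonempty_iff_eq_empty] at h
    rw [mdepth, h] at h3
    simp at h3
  obtain ⟨k, ⟨rs, hk, hmem, hreg⟩, hlt⟩ := exists_lt_of_lt_csSup hne h3
  obtain ⟨r, s, t, rs, rfl⟩ : ∃ r s t rs', rs = r :: s :: t :: rs' := by
    match rs, hk with
    | [], hk => simp at hk; omega
    | [_], hk => simp at hk; omega
    | [_, _], hk => simp at hk; omega
    | r :: s :: t :: rs', _ => exact ⟨r, s, t, rs', rfl⟩
  have hw := hreg.1
  simp only [RingTheory.Sequence.isWeaklyRegular_cons_iff] at hw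
  obtain ⟨h1, h2, h3, -⟩ := hw
  have hzero : ∀ q : I, (Submodule.Quotient.mk q : quotMod K n I J) = 0 ↔
      (q : MvPolynomial (Fin n) K) ∈ J := by
    intro q
    rw [Submodule.Quotient.mk_eq_zero]
    rfl
  obtain ⟨m', hm'⟩ := exists_eq_smul_sub_smul_of_koszul_cocycle X (hmem r (by simp))
    (hmem s (by simp)) (hmem t (by simp)) h1 h2 h3
    (fun i j ↦ (Submodule.Quotient.mk ⟨p i j, hpI i j⟩ : quotMod K n I J))
    (fun i j ↦ by
      rw [← Submodule.Quotient.mk_neg]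
      congr 1
      exact Subtype.ext (hanti i j))
    (fun i j k ↦ by
      simp only [← Submodule.Quotient.mk_smul, ← Submodule.Quotient.mk_sub,
        ← Submodule.Quotient.mk_add]
      exact (hzero _).2 (hp i j k))
  choose N hN using fun i ↦ Submodule.Quotient.mk_surjective _ (m' i)
  refine ⟨fun i ↦ N i, fun i ↦ (N i).2, fun i k ↦ ?_⟩
  have := hm' i k
  simp only [← hN] at this
  rw [← sub_eq_zero, ← Submodule.Quotient.mk_smul, ← Submodule.Quotient.mk_smul,
    ← Submodule.Quotient.mk_sub, ← Submodule.Quotient.mk_sub, hzero] at this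
  exact this

/-- A form of the Cauchy–Binet formula: if `∑ e ∈ S, d e ⊗ p e` is injective from `V'` to
the quotient by `W'`, then for some `L ⊆ S` the functionals `d e`, `e ∈ L`, separate the points
of `V'` and the vectors `p e`, `e ∈ L`, are linearly independent modulo `W'`. -/
theorem exists_subset_separating_and_independent {K V W ι : Type*} [Field K] [AddCommGroup V]
    [Module K V] [AddCommGroup W] [Module K W] [DecidableEq ι] (d : ι → V →ₗ[K] K) (p : ι → W)
    (S : Finset ι) (V' : Submodule K V) (W' : Submodule K W)
    (h : ∀ v ∈ V', ∑ e ∈ S, d e v • p e ∈ W' → v = 0) :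
    ∃ L ⊆ S, (∀ v ∈ V', (∀ e ∈ L, d e v = 0) → v = 0) ∧
      ∀ c : ι → K, ∑ e ∈ L, c e • p e ∈ W' → ∀ e ∈ L, c e = 0 := by
  induction S using Finset.induction_on generalizing V' W' with
  | empty => exact ⟨∅, subset_rfl, fun v hv _ ↦ h v hv (by simp), by simp⟩
  | insert a S ha ih =>
    by_cases h' : ∀ v ∈ V', ∑ e ∈ S, d e v • p e ∈ W' → v = 0
    · obtain ⟨L, hL, hsep, hind⟩ := ih V' W' h'
      exact ⟨L, hL.trans (Finset.subset_insert _ _), hsep, hind⟩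
    push Not at h'
    obtain ⟨v, hv, hvW, hv0⟩ := h'
    have hdv : d a v ≠ 0 := by
      intro hc
      refine hv0 (h v hv ?_)
      rwa [Finset.sum_insert ha, hc, zero_smul, zero_add]
    obtain ⟨L, hL, hsep, hind⟩ := ih (V' ⊓ LinearMap.ker (d a)) (W' ⊔ K ∙ p a) (by
      rintro u ⟨hu, hua⟩ hmem
      replace hua : d a u = 0 := hua
      obtain ⟨w, hw, q, hq, hsum⟩ := Submodule.mem_sup.1 hmem
      obtain ⟨c, rfl⟩ := Submodule.mem_span_singleton.1 hq
      have hz := h (u - (c / d a v) • v) (V'.sub_mem hu (V'.smul_mem _ hv)) (by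
        have hrw : ∑ e ∈ insert a S, d e (u - (c / d a v) • v) • p e =
            w - (c / d a v) • ∑ e ∈ S, d e v • p e := by
          simp only [map_sub, map_smul, sub_smul, Finset.sum_sub_distrib, smul_assoc,
            ← Finset.smul_sum]
          rw [Finset.sum_insert ha, Finset.sum_insert ha, hua, ← hsum, zero_smul, zero_add,
            smul_add, smul_smul, div_mul_cancel₀ _ hdv]
          abel
        rw [hrw]
        exact W'.sub_mem hw (W'.smul_mem _ hvW))
      have hc : c = 0 := by
        have := congrArg (d a) hz
        rw [map_sub, map_smul, hua, smul_eq_mul, div_mul_cancel₀ _ hdv, map_zero, zero_sub,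
          neg_eq_zero] at this
        exact this
      rw [sub_eq_zero.1 hz, hc, zero_div, zero_smul])
    have haL : a ∉ L := fun hc ↦ ha (hL hc)
    refine ⟨insert a L, Finset.insert_subset_insert _ hL, fun u hu hu0 ↦ ?_, fun c hc ↦ ?_⟩
    · exact hsep u ⟨hu, hu0 a (Finset.mem_insert_self _ _)⟩
        fun e he ↦ hu0 e (Finset.mem_insert_of_mem he)
    · rw [Finset.sum_insert haL] at hc
      have hcL := hind c (by
        have : ∑ e ∈ L, c e • p e = (c a • p a + ∑ e ∈ L, c e • p e) + (-c a) • p a := by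
          rw [neg_smul]; abel
        rw [this]
        exact Submodule.add_mem_sup hc (Submodule.smul_mem _ _ (Submodule.mem_span_singleton_self _)))
      have hca : c a = 0 := by
        by_contra hne
        rw [Finset.sum_eq_zero fun e he ↦ by rw [hcL e he, zero_smul], add_zero] at hc
        have hp : p a ∈ W' := by
          have := W'.smul_mem (c a)⁻¹ hc
          rwa [smul_smul, inv_mul_cancel₀ hne, one_smul] at this
        refine hv0 (h v hv ?_)
        rw [Finset.sum_insert ha]
        exact W'.add_mem (W'.smul_mem _ hp) hvW
      intro e he
      rcases Finset.mem_insert.1 he with rfl | he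
      · exact hca
      · exact hcL e he

/-- An injective linear map between coordinate spaces admits a transversal inside its support. -/
theorem exists_injOn_of_injective {K α β : Type*} [Field K] [Nonempty β]
    (A : Finset α) (B : Finset β) (r : α → β → Prop) (Φ : (α → K) →ₗ[K] (β → K))
    (hr : ∀ f b, b ∈ B → (∀ a ∈ A, r a b → f a = 0) → (∀ a ∉ A, f a = 0) → Φ f b = 0)
    (hinj : ∀ f, (∀ a ∉ A, f a = 0) → (∀ b ∈ B, Φ f b = 0) → f = 0) :
    ∃ μ : α → β, Set.InjOn μ A ∧ ∀ a ∈ A, μ a ∈ B ∧ r a (μ a) := by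
  classical
  obtain ⟨m, hm, hmB⟩ := (Finset.all_card_le_biUnion_card_iff_exists_injective
    fun a : A ↦ B.filter fun b ↦ r a b).1 (by
      intro X
      set N := X.biUnion fun a : A ↦ B.filter fun b ↦ r a b
      let ext : (X → K) →ₗ[K] (α → K) :=
        { toFun := fun f a ↦ if h : ∃ h : a ∈ A, ⟨a, h⟩ ∈ X then f ⟨⟨a, h.1⟩, h.2⟩ else 0
          map_add' := fun f g ↦ by ext a; simp only [Pi.add_apply]; split_ifs <;> simp
          map_smul' := fun c f ↦ by ext a; simp only [Pi.smul_apply]; split_ifs <;> simp }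
      let Ψ : (X → K) →ₗ[K] (N → K) := (LinearMap.funLeft K K (fun b : N ↦ (b : β))) ∘ₗ Φ ∘ₗ ext
      have hΨ : Function.Injective Ψ := by
        rw [injective_iff_map_eq_zero]
        intro f hf
        have hA : ∀ a ∉ A, ext f a = 0 := fun a ha ↦ dif_neg fun h ↦ ha h.1
        have h0 : ext f = 0 := hinj _ hA fun b hb ↦ by
          by_cases hbN : b ∈ N
          · exact congrFun hf ⟨b, hbN⟩
          · refine hr _ b hb (fun a ha hab ↦ dif_neg ?_) hA
            rintro ⟨h, hX⟩
            exact hbN (Finset.mem_biUnion.2 ⟨_, hX, Finset.mem_filter.2 ⟨hb, hab⟩⟩)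
        ext a
        have := congrFun h0 a.1.1
        have hex : ∃ h : a.1.1 ∈ A, (⟨a.1.1, h⟩ : A) ∈ X := ⟨a.1.2, a.2⟩
        simpa [ext, hex] using this
      simpa using LinearMap.finrank_le_finrank_of_injective hΨ)
  refine ⟨fun a ↦ if h : a ∈ A then m ⟨a, h⟩ else Classical.arbitrary β, ?_, ?_⟩
  · intro a ha b hb hab
    simp only [Finset.mem_coe] at ha hb
    simp only [ha, hb, dif_pos] at hab
    exact congrArg Subtype.val (hm hab)
  · intro a ha
    simp only [ha, dif_pos]
    exact Finset.mem_filter.1 (hmB ⟨a, ha⟩)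

/-- The simplicial coboundary on functions of finite subsets of `Fin n`. -/
noncomputable def cob (K : Type*) [Field K] (n : ℕ) :
    (Finset (Fin n) → K) →ₗ[K] (Finset (Fin n) → K) where
  toFun f T := ∑ x ∈ T, (-1) ^ (T.filter (· < x)).card * f (T.erase x)
  map_add' f g := by
    ext T
    simp [mul_add, Finset.sum_add_distrib]
  map_smul' c f := by
    ext T
    simp [Finset.mul_sum, mul_left_comm]

theorem cob_apply {K : Type*} [Field K] {n : ℕ} (f : Finset (Fin n) → K) (T : Finset (Fin n)) :
    cob K n f T = ∑ x ∈ T, (-1) ^ (T.filter (· < x)).card * f (T.erase x) := rfl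

theorem cob_congr {K : Type*} [Field K] {n : ℕ} {f g : Finset (Fin n) → K} {T : Finset (Fin n)}
    (h : ∀ x ∈ T, f (T.erase x) = g (T.erase x)) : cob K n f T = cob K n g T := by
  rw [cob_apply, cob_apply]
  exact Finset.sum_congr rfl fun x hx ↦ by rw [h x hx]

theorem cob_eq_zero {K : Type*} [Field K] {n : ℕ} {f : Finset (Fin n) → K} {T : Finset (Fin n)}
    (h : ∀ x ∈ T, f (T.erase x) = 0) : cob K n f T = 0 := by
  rw [cob_apply]
  exact Finset.sum_eq_zero fun x hx ↦ by rw [h x hx, mul_zero]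

theorem cob_pair {K : Type*} [Field K] {n : ℕ} (f : Finset (Fin n) → K) {i j : Fin n}
    (hij : i < j) : cob K n f {i, j} = f {j} - f {i} := by
  have h1 : ({i, j} : Finset (Fin n)).erase i = {j} := by
    ext y; simp; grind
  have h2 : ({i, j} : Finset (Fin n)).erase j = {i} := by
    ext y; simp; grind
  rw [cob_apply, Finset.sum_pair hij.ne, h1, h2]
  simp [Finset.filter_insert, Finset.filter_singleton, hij, hij.not_gt, sub_eq_add_neg]

theorem cob_triple {K : Type*} [Field K] {n : ℕ} (f : Finset (Fin n) → K) {i j k : Fin n}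
    (hij : i < j) (hjk : j < k) :
    cob K n f {i, j, k} = f {j, k} - f {i, k} + f {i, j} := by
  have hik := hij.trans hjk
  have h1 : ({i, j, k} : Finset (Fin n)).erase i = {j, k} := by
    ext y; simp; grind
  have h2 : ({i, j, k} : Finset (Fin n)).erase j = {i, k} := by
    ext y; simp; grind
  have h3 : ({i, j, k} : Finset (Fin n)).erase k = {i, j} := by
    ext y; simp; grind
  rw [cob_apply, Finset.sum_insert (by simp [hij.ne, hik.ne]), Finset.sum_pair hjk.ne, h1, h2, h3]
  simp [Finset.filter_insert, Finset.filter_singleton, hij, hij.not_gt, hjk, hjk.not_gt, hik,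
    hik.not_gt, hij.ne]
  ring

theorem cob_insert_zero {K : Type*} [Field K] {n : ℕ} [NeZero n] (f : Finset (Fin n) → K)
    {e : Finset (Fin n)} (he : (0 : Fin n) ∉ e) :
    cob K n f (insert 0 e) = f e - cob K n (fun T ↦ f (insert 0 T)) e := by
  rw [cob_apply, cob_apply, Finset.sum_insert he, Finset.erase_insert he, sub_eq_add_neg,
    ← Finset.sum_neg_distrib]
  congr 1
  · simp
  · refine Finset.sum_congr rfl fun x hx ↦ ?_
    have hx0 : x ≠ 0 := fun h ↦ he (h ▸ hx)
    have hpos : (0 : Fin n) < x := Fin.pos_iff_ne_zero.2 hx0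
    rw [Finset.filter_insert, if_pos hpos, Finset.card_insert_of_notMem (by simp [he]),
      Finset.erase_insert_of_ne hx0.symm, pow_succ]
    ring

/-- If the coboundary is exact on the degree two part of `P` (with only `{0}` in degree one),
then the elements of degree two not below `{0, i, j}` can be matched into degree three. -/
theorem exists_matching_of_exact {n : ℕ} [NeZero n] {K : Type*} [Field K]
    (P : Set (Finset (Fin n)))
    (hzero : ∀ T T', T' ∈ P → T ⊆ T' → (0 : Fin n) ∈ T → T ∈ P)
    (hlink : ∀ e : Finset (Fin n), e.card = 2 → (0 : Fin n) ∉ e → insert 0 e ∈ P → e ∈ P)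
    (hex : ∀ f : Finset (Fin n) → K, (∀ T, ¬ (T ∈ P ∧ T.card = 2) → f T = 0) →
      (∀ T ∈ P, T.card = 3 → cob K n f T = 0) →
      (∀ e ∈ P, (0 : Fin n) ∉ e → f e = 0) ∧
      ∀ a b : Fin n, a ≠ 0 → b ≠ 0 → {0, a} ∈ P → {0, b} ∈ P → f {0, a} = f {0, b})
    (hA : ∃ a b : Fin n, a ≠ 0 ∧ b ≠ 0 ∧ a ≠ b ∧ {0, a} ∈ P ∧ {0, b} ∈ P) :
    ∃ i j : Fin n, i ≠ 0 ∧ j ≠ 0 ∧ i ≠ j ∧ {0, i, j} ∈ P ∧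
      ∃ μ : Finset (Fin n) → Finset (Fin n),
        Set.InjOn μ {b | b ∈ P ∧ b.card = 2 ∧ b ≠ {0, i} ∧ b ≠ {0, j}} ∧
        ∀ b ∈ P, b.card = 2 → b ≠ {0, i} → b ≠ {0, j} →
          μ b ∈ P ∧ (μ b).card = 3 ∧ b ⊆ μ b ∧ μ b ≠ {0, i, j} := by
  classical
  obtain ⟨a, b, ha0, hb0, hab, haP, hbP⟩ := hA
  set E₁ : Finset (Finset (Fin n)) :=
    Finset.univ.filter fun e ↦ e.card = 2 ∧ (0 : Fin n) ∉ e ∧ insert 0 e ∈ P with hE₁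
  set E₂ : Finset (Finset (Fin n)) :=
    Finset.univ.filter fun e ↦ e.card = 2 ∧ (0 : Fin n) ∉ e ∧ e ∈ P ∧ insert 0 e ∉ P with hE₂
  have mem₁ : ∀ e, e ∈ E₁ ↔ e.card = 2 ∧ (0 : Fin n) ∉ e ∧ insert 0 e ∈ P := by simp [hE₁]
  have mem₂ : ∀ e, e ∈ E₂ ↔ e.card = 2 ∧ (0 : Fin n) ∉ e ∧ e ∈ P ∧ insert 0 e ∉ P := by
    simp [hE₂]
  have hins : ∀ T : Finset (Fin n), insert 0 T ∉ E₁ ∧ insert 0 T ∉ E₂ := fun T ↦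
    ⟨fun h ↦ ((mem₁ _).1 h).2.1 (Finset.mem_insert_self _ _),
      fun h ↦ ((mem₂ _).1 h).2.1 (Finset.mem_insert_self _ _)⟩
  have hpair : ∀ T : Finset (Fin n), T.card = 2 → (0 : Fin n) ∈ T →
      ∃ v, v ≠ 0 ∧ T = {0, v} := by
    intro T hT h0
    obtain ⟨v, hv⟩ := Finset.card_eq_one.1 (by rw [Finset.card_erase_of_mem h0, hT] :
      (T.erase 0).card = 1)
    have hv0 : v ∈ T.erase 0 := hv ▸ Finset.mem_singleton_self v
    exact ⟨v, Finset.ne_of_mem_erase hv0, by rw [← hv, Finset.insert_erase h0]⟩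
  have hker : ∀ f : Finset (Fin n) → K, (∀ T, ¬ (T ∈ P ∧ T.card = 2) → f T = 0) →
      f {0, a} = 0 → (∀ T ∈ P, T.card = 3 → cob K n f T = 0) → f = 0 := by
    intro f hf ha hc
    obtain ⟨h1, h2⟩ := hex f hf hc
    ext T
    by_cases hT : T ∈ P ∧ T.card = 2
    · by_cases h0 : (0 : Fin n) ∈ T
      · obtain ⟨v, hv, rfl⟩ := hpair T hT.2 h0
        rw [h2 v a hv ha0 hT.1 haP, ha, Pi.zero_apply]
      · exact h1 T hT.1 h0
    · exact hf T hT
  let d : Finset (Fin n) → (Finset (Fin n) → K) →ₗ[K] K := fun e ↦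
    LinearMap.proj e ∘ₗ cob K n ∘ₗ LinearMap.funLeft K K (insert 0)
  have d_apply : ∀ e f, d e f = cob K n (fun T ↦ f (insert 0 T)) e := fun _ _ ↦ rfl
  let res : (Finset (Fin n) → K) →ₗ[K] (Finset (Fin n) → K) := LinearMap.pi fun T ↦
    if T ∈ P ∧ T.card = 3 ∧ (0 : Fin n) ∉ T then LinearMap.proj T else 0
  have res_pos : ∀ f T, T ∈ P → T.card = 3 → (0 : Fin n) ∉ T → res f T = f T := by
    intro f T h1 h2 h3
    simp [res, h1, h2, h3]
  have res_eq_zero : ∀ f, (∀ T ∈ P, T.card = 3 → (0 : Fin n) ∉ T → f T = 0) → res f = 0 := by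
    intro f hf
    ext T
    by_cases h : T ∈ P ∧ T.card = 3 ∧ (0 : Fin n) ∉ T
    · rw [res_pos _ _ h.1 h.2.1 h.2.2, hf T h.1 h.2.1 h.2.2, Pi.zero_apply]
    · simp only [res, LinearMap.pi_apply, if_neg h, LinearMap.zero_apply, Pi.zero_apply]
  let V' : Submodule K (Finset (Fin n) → K) :=
    { carrier := {f | ∀ T, ¬ (T ∈ P ∧ T.card = 2 ∧ (0 : Fin n) ∈ T ∧ T ≠ {0, a}) → f T = 0}
      add_mem' := fun {f g} hf hg T hT ↦ by rw [Pi.add_apply, hf T hT, hg T hT, add_zero]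
      zero_mem' := fun T _ ↦ rfl
      smul_mem' := fun c f hf T hT ↦ by rw [Pi.smul_apply, hf T hT, smul_zero] }
  let U : Submodule K (Finset (Fin n) → K) :=
    { carrier := {f | ∀ T ∉ E₂, f T = 0}
      add_mem' := fun {f g} hf hg T hT ↦ by rw [Pi.add_apply, hf T hT, hg T hT, add_zero]
      zero_mem' := fun T _ ↦ rfl
      smul_mem' := fun c f hf T hT ↦ by rw [Pi.smul_apply, hf T hT, smul_zero] }
  have hsingle : ∀ (L : Finset (Finset (Fin n))) (c : Finset (Fin n) → K),
      ∑ e ∈ L, c e • res (cob K n (Pi.single e 1)) =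
        res (cob K n (fun T ↦ if T ∈ L then c T else 0)) := by
    intro L c
    have : (fun T ↦ if T ∈ L then c T else 0) = ∑ e ∈ L, c e • (Pi.single e 1 : _ → K) := by
      ext T
      simp [Finset.sum_apply, Pi.single_apply]
    rw [this, map_sum, map_sum]
    simp only [map_smul]
  obtain ⟨L, hL, hsep, hind⟩ := exists_subset_separating_and_independent d
    (fun e ↦ res (cob K n (Pi.single e 1))) E₁ V' (U.map (res ∘ₗ cob K n)) (by
      rintro v hv ⟨h, hh, hsum⟩
      rw [hsingle] at hsum
      replace hsum : res (cob K n h) = _ := hsum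
      set w : Finset (Fin n) → K := fun T ↦ if T ∈ E₁ then d T v else 0 with hw
      have hv' : ∀ T : Finset (Fin n), (0 : Fin n) ∉ T → v T = 0 :=
        fun T hT ↦ hv T fun hc ↦ hT hc.2.2.1
      have hf := hker (v + w - h) (by
        intro T hT
        have h1 : T ∉ E₁ := fun hc ↦
          hT ⟨hlink T ((mem₁ T).1 hc).1 ((mem₁ T).1 hc).2.1 ((mem₁ T).1 hc).2.2, ((mem₁ T).1 hc).1⟩
        have h2 : T ∉ E₂ := fun hc ↦ hT ⟨((mem₂ T).1 hc).2.2.1, ((mem₂ T).1 hc).1⟩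
        simp only [Pi.add_apply, Pi.sub_apply]
        rw [hv T fun hc ↦ hT ⟨hc.1, hc.2.1⟩, hh T h2, hw]
        simp [h1]) (by
        simp only [Pi.add_apply, Pi.sub_apply]
        rw [hv _ fun hc ↦ hc.2.2.2 rfl, hh _ (hins _).2, hw]
        simp [(hins _).1]) (by
        intro T hT h3
        by_cases h0 : (0 : Fin n) ∈ T
        · obtain ⟨e, he0, rfl⟩ : ∃ e, (0 : Fin n) ∉ e ∧ T = insert 0 e :=
            ⟨T.erase 0, Finset.notMem_erase _ _, (Finset.insert_erase h0).symm⟩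
          rw [Finset.card_insert_of_notMem he0] at h3
          have he₁ : e ∈ E₁ := (mem₁ e).2 ⟨by omega, he0, hT⟩
          have he₂ : e ∉ E₂ := fun hc ↦ ((mem₂ e).1 hc).2.2.2 hT
          rw [cob_insert_zero _ he0]
          have : cob K n (fun T ↦ (v + w - h) (insert 0 T)) e = d e v := by
            rw [d_apply]
            refine cob_congr fun x _ ↦ ?_
            simp only [Pi.add_apply, Pi.sub_apply]
            rw [hh _ (hins _).2, hw]
            simp [(hins _).1]
          rw [this]
          simp only [Pi.add_apply, Pi.sub_apply]
          rw [hh _ he₂, hv' e he0, hw]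
          simp [he₁]
        · rw [map_sub, map_add]
          simp only [Pi.add_apply, Pi.sub_apply]
          have hvT : cob K n v T = 0 := cob_eq_zero fun x hx ↦
            hv' _ fun hc ↦ h0 (Finset.mem_of_mem_erase hc)
          have := congrFun hsum T
          rw [res_pos _ _ hT h3 h0, res_pos _ _ hT h3 h0] at this
          rw [hvT, this, zero_add, sub_self])
      ext T
      by_cases h0 : (0 : Fin n) ∈ T
      · have := congrFun hf T
        have hT := hins T
        rw [Finset.insert_eq_of_mem h0] at hT
        simp only [Pi.add_apply, Pi.sub_apply] at this
        rw [hh _ hT.2, hw] at this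
        simpa [hT.1] using this
      · exact hv' T h0)
  obtain ⟨e₀, he₀L, hae₀⟩ : ∃ e ∈ L, a ∈ e := by
    by_contra! hno
    have hv := hsep
      (fun T ↦ if T ∈ P ∧ T.card = 2 ∧ (0 : Fin n) ∈ T ∧ T ≠ {0, a} then 1 else 0)
      (fun T hT ↦ if_neg hT) (by
        intro e he
        obtain ⟨hcard, h0, hP⟩ := (mem₁ e).1 (hL he)
        have hone : ∀ x ∈ e, (insert 0 {x} : Finset (Fin n)) ∈ P ∧
            (insert 0 {x} : Finset (Fin n)).card = 2 ∧
            (0 : Fin n) ∈ (insert 0 {x} : Finset (Fin n)) ∧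
            (insert 0 {x} : Finset (Fin n)) ≠ {0, a} := by
          intro x hx
          have hx0 : x ≠ 0 := fun h ↦ h0 (h ▸ hx)
          refine ⟨hzero _ _ hP ?_ (by simp), Finset.card_pair hx0.symm, by simp, fun hc ↦ ?_⟩
          · exact Finset.insert_subset_insert _ (Finset.singleton_subset_iff.2 hx)
          · have : a ∈ (insert 0 {x} : Finset (Fin n)) := hc ▸ by simp
            simp only [Finset.mem_insert, Finset.mem_singleton, ha0, false_or] at this
            exact hno e he (this ▸ hx)
        have key : ∀ x y : Fin n, e = {x, y} → x < y → d e (fun T ↦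
            if T ∈ P ∧ T.card = 2 ∧ (0 : Fin n) ∈ T ∧ T ≠ {0, a} then 1 else 0) = 0 := by
          intro x y hxy hlt
          have hx := hone x (by simp [hxy])
          have hy := hone y (by simp [hxy])
          rw [d_apply, hxy, cob_pair _ hlt, if_pos hx, if_pos hy, sub_self]
        obtain ⟨x, y, hxy, he⟩ := Finset.card_eq_two.1 hcard
        rcases hxy.lt_or_gt with hlt | hlt
        · exact key x y he hlt
        · exact key y x (he.trans (Finset.pair_comm _ _)) hlt)
    have := congrFun hv {0, b}
    have hne : ({0, b} : Finset (Fin n)) ≠ {0, a} := by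
      intro hc
      have : a ∈ ({0, b} : Finset (Fin n)) := hc ▸ by simp
      simp [ha0, hab] at this
    simp [hbP, Finset.card_pair hb0.symm, hne] at this
  obtain ⟨hcard₀, h0₀, hP₀⟩ := (mem₁ e₀).1 (hL he₀L)
  obtain ⟨j, hj⟩ := Finset.card_eq_one.1 (by rw [Finset.card_erase_of_mem hae₀, hcard₀] :
    (e₀.erase a).card = 1)
  have hje : j ∈ e₀.erase a := hj ▸ Finset.mem_singleton_self j
  have hja : a ≠ j := (Finset.ne_of_mem_erase hje).symm
  have hj0 : j ≠ 0 := fun h ↦ h0₀ (h ▸ Finset.mem_of_mem_erase hje)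
  have he₀ : e₀ = {a, j} := by rw [← hj, Finset.insert_erase hae₀]
  rw [he₀] at he₀L
  have hP₁ : ({0, a, j} : Finset (Fin n)) ∈ P := he₀ ▸ hP₀
  refine ⟨a, j, ha0, hj0, hja, hP₁, ?_⟩
  let cut : (Finset (Fin n) → K) →ₗ[K] (Finset (Fin n) → K) := LinearMap.pi fun T ↦
    if T ∈ L ∨ T ∈ E₂ then LinearMap.proj T else 0
  have cut_apply : ∀ f T, cut f T = if T ∈ L ∨ T ∈ E₂ then f T else 0 := by
    intro f T
    simp only [cut, LinearMap.pi_apply]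
    split_ifs <;> rfl
  let Φ : (Finset (Fin n) → K) →ₗ[K] (Finset (Fin n) → K) := LinearMap.pi fun T ↦
    if (0 : Fin n) ∈ T then
      if T.erase 0 ∈ L then d (T.erase 0) else LinearMap.proj (T.erase 0)
    else LinearMap.proj T ∘ₗ cob K n ∘ₗ cut
  have Φ_sep : ∀ f e, (0 : Fin n) ∉ e → e ∈ L → Φ f (insert 0 e) = d e f := by
    intro f e h0 he
    simp [Φ, Finset.erase_insert h0, he]
  have Φ_id : ∀ f e, (0 : Fin n) ∉ e → e ∉ L → Φ f (insert 0 e) = f e := by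
    intro f e h0 he
    simp [Φ, Finset.erase_insert h0, he]
  have Φ_cob : ∀ f T, (0 : Fin n) ∉ T → Φ f T = cob K n (cut f) T := by
    intro f T h0
    simp [Φ, h0]
  obtain ⟨μ, hμ, hμ'⟩ := exists_injOn_of_injective
    (Finset.univ.filter fun b : Finset (Fin n) ↦ b ∈ P ∧ b.card = 2 ∧ b ≠ {0, a} ∧ b ≠ {0, j})
    (Finset.univ.filter fun T : Finset (Fin n) ↦ T ∈ P ∧ T.card = 3 ∧ T ≠ {0, a, j})
    (· ⊆ ·) Φ (by
      intro f T _ hsub hout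
      have hz : ∀ c ⊆ T, f c = 0 := fun c hc ↦ by
        by_cases hcA : c ∈ Finset.univ.filter fun b : Finset (Fin n) ↦
            b ∈ P ∧ b.card = 2 ∧ b ≠ {0, a} ∧ b ≠ {0, j}
        · exact hsub c hcA hc
        · exact hout c hcA
      by_cases h0 : (0 : Fin n) ∈ T
      · obtain ⟨e, he0, rfl⟩ : ∃ e, (0 : Fin n) ∉ e ∧ T = insert 0 e :=
          ⟨T.erase 0, Finset.notMem_erase _ _, (Finset.insert_erase h0).symm⟩
        by_cases heL : e ∈ L
        · rw [Φ_sep f e he0 heL, d_apply]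
          exact cob_eq_zero fun x _ ↦ hz _ (Finset.insert_subset_insert _ (Finset.erase_subset _ _))
        · rw [Φ_id f e he0 heL]
          exact hz _ (Finset.subset_insert _ _)
      · rw [Φ_cob f T h0]
        refine cob_eq_zero fun x _ ↦ ?_
        rw [cut_apply, hz _ (Finset.erase_subset _ _), ite_self]) (by
      simp only [Finset.mem_filter, Finset.mem_univ, true_and]
      intro f hout hΦ
      have hins_ne : ∀ e : Finset (Fin n), (0 : Fin n) ∉ e → e ≠ {a, j} →
          (insert 0 e : Finset (Fin n)) ≠ {0, a, j} := by
        intro e he hne hc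
        apply hne
        have := congrArg (fun T ↦ Finset.erase T 0) hc
        simpa [Finset.erase_insert he, Finset.erase_insert (he₀ ▸ h0₀)] using this
      have hB : ∀ e ∈ E₁, e ≠ {a, j} → Φ f (insert 0 e) = 0 := by
        intro e he hne
        obtain ⟨h2, h0, hP⟩ := (mem₁ e).1 he
        exact hΦ _ ⟨hP, by rw [Finset.card_insert_of_notMem h0, h2], hins_ne e h0 hne⟩
      have hf0 : ∀ T, (0 : Fin n) ∈ T → f T = 0 := by
        have hg := hsep (fun T ↦ if (0 : Fin n) ∈ T then f T else 0) (by
          intro T hT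
          dsimp only
          split_ifs with h0
          · exact hout T fun hc ↦ hT ⟨hc.1, hc.2.1, h0, hc.2.2.1⟩
          · rfl) (by
          intro e he
          have hde : d e (fun T ↦ if (0 : Fin n) ∈ T then f T else 0) = d e f := by
            rw [d_apply, d_apply]
            exact cob_congr fun x _ ↦ by simp
          rw [hde]
          by_cases hne : e = {a, j}
          · rw [hne, d_apply]
            refine cob_eq_zero fun x hx ↦ hout _ fun hc ↦ ?_
            simp only [Finset.mem_insert, Finset.mem_singleton] at hx
            rcases hx with rfl | rfl
            · refine hc.2.2.2 ?_
              rw [Finset.erase_insert (by simpa using hja)]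
            · refine hc.2.2.1 ?_
              rw [Finset.pair_comm, Finset.erase_insert (by simpa using hja.symm)]
          · rw [← Φ_sep f e ((mem₁ e).1 (hL he)).2.1 he]
            exact hB e (hL he) hne)
        intro T h0
        have := congrFun hg T
        simpa [h0] using this
      have hf1 : ∀ e ∈ E₁, e ∉ L → f e = 0 := by
        intro e he heL
        rw [← Φ_id f e ((mem₁ e).1 he).2.1 heL]
        exact hB e he fun hc ↦ heL (hc ▸ he₀L)
      have hcut : ∀ T ∈ P, T.card = 3 → (0 : Fin n) ∉ T → cob K n (cut f) T = 0 := by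
        intro T hT h3 h0
        rw [← Φ_cob f T h0]
        refine hΦ T ⟨hT, h3, ?_⟩
        rintro rfl
        simp at h0
      have hdisj : ∀ e ∈ L, e ∉ E₂ := fun e he hc ↦
        ((mem₂ e).1 hc).2.2.2 ((mem₁ e).1 (hL he)).2.2
      have hfL : ∀ e ∈ L, f e = 0 := by
        refine hind f ?_
        rw [hsingle]
        refine ⟨-(fun T ↦ if T ∈ E₂ then f T else 0), fun T hT ↦ by simp [hT], ?_⟩
        have hsplit : cut f = (fun T ↦ if T ∈ L then f T else 0) +
            fun T ↦ if T ∈ E₂ then f T else 0 := by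
          ext T
          rw [cut_apply, Pi.add_apply]
          by_cases h1 : T ∈ L
          · simp [h1, hdisj T h1]
          · simp [h1]
        have hz := res_eq_zero _ hcut
        rw [hsplit, map_add, map_add] at hz
        rw [LinearMap.comp_apply, map_neg, map_neg]
        exact (eq_neg_of_add_eq_zero_left hz).symm
      have hcut₂ : ∀ T ∉ E₂, cut f T = 0 := by
        intro T hT
        rw [cut_apply]
        split_ifs with h
        · exact hfL T (h.resolve_right hT)
        · rfl
      have hcut0 := hker (cut f) (fun T hT ↦ hcut₂ T fun hc ↦
          hT ⟨((mem₂ T).1 hc).2.2.1, ((mem₂ T).1 hc).1⟩) (hcut₂ _ (hins _).2) (by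
        intro T hT h3
        by_cases h0 : (0 : Fin n) ∈ T
        · obtain ⟨e, he0, rfl⟩ : ∃ e, (0 : Fin n) ∉ e ∧ T = insert 0 e :=
            ⟨T.erase 0, Finset.notMem_erase _ _, (Finset.insert_erase h0).symm⟩
          have hz : cob K n (fun T ↦ cut f (insert 0 T)) e = 0 :=
            cob_eq_zero fun x _ ↦ hcut₂ _ (hins _).2
          rw [cob_insert_zero _ he0, hcut₂ e fun hc ↦ ((mem₂ e).1 hc).2.2.2 hT, hz, sub_zero]
        · exact hcut T hT h3 h0)
      ext T
      by_cases h0 : (0 : Fin n) ∈ T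
      · exact hf0 T h0
      by_cases hT : T ∈ P ∧ T.card = 2
      · by_cases hTL : T ∈ L
        · exact hfL T hTL
        by_cases hT₁ : T ∈ E₁
        · exact hf1 T hT₁ hTL
        have hT₂ : T ∈ E₂ := (mem₂ T).2
          ⟨hT.2, h0, hT.1, fun hc ↦ hT₁ ((mem₁ T).2 ⟨hT.2, h0, hc⟩)⟩
        have := congrFun hcut0 T
        rwa [cut_apply, if_pos (Or.inr hT₂)] at this
      · exact hout T fun hc ↦ hT ⟨hc.1, hc.2.1⟩)
  simp only [Finset.mem_filter, Finset.mem_univ, true_and] at hμ'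
  refine ⟨μ, fun x hx y hy h ↦ hμ (by simpa using hx) (by simpa using hy) h, ?_⟩
  intro c h1 h2 h3 h4
  obtain ⟨⟨hP, hc, hne⟩, hs⟩ := hμ' c ⟨h1, h2, h3, h4⟩
  exact ⟨hP, hc, hs, hne⟩

/-- A matching of the degree two elements into degree three yields a partition all of whose
intervals end in degree at least three. -/
theorem exists_partition_of_matching {n : ℕ} [NeZero n] (P : Set (Finset (Fin n)))
    (h0 : {0} ∈ P) (hcard : ∀ T ∈ P, T ≠ {0} → 2 ≤ T.card) {i j : Fin n} (hi : i ≠ 0)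
    (hj : j ≠ 0) (hij : i ≠ j) (hP : {0, i, j} ∈ P) (μ : Finset (Fin n) → Finset (Fin n))
    (hinj : Set.InjOn μ {b | b ∈ P ∧ b.card = 2 ∧ b ≠ {0, i} ∧ b ≠ {0, j}})
    (hμ : ∀ b ∈ P, b.card = 2 → b ≠ {0, i} → b ≠ {0, j} →
      μ b ∈ P ∧ (μ b).card = 3 ∧ b ⊆ μ b ∧ μ b ≠ {0, i, j}) :
    ∃ pt : SqfPartition n P, ∀ p ∈ pt.intervals, 3 ≤ p.2.card := by
  classical
  set Q : Set (Finset (Fin n)) := {b | b ∈ P ∧ b.card = 2 ∧ b ≠ {0, i} ∧ b ≠ {0, j}} with hQ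
  have hμQ : ∀ b ∈ Q, μ b ∈ P ∧ (μ b).card = 3 ∧ b ⊆ μ b ∧ μ b ≠ {0, i, j} :=
    fun b hb ↦ hμ b hb.1 hb.2.1 hb.2.2.1 hb.2.2.2
  have h3 : ({0, i, j} : Finset (Fin n)).card = 3 := by
    rw [Finset.card_insert_of_notMem (by simp [hi.symm, hj.symm]), Finset.card_pair hij]
  have hbig : ∀ T : Finset (Fin n), 3 ≤ T.card → T ⊆ {0, i, j} → T = {0, i, j} :=
    fun T hT hs ↦ Finset.eq_of_subset_of_card_le hs (by omega)
  have htwo : ∀ T : Finset (Fin n), T.card = 2 → (0 : Fin n) ∈ T → T ⊆ {0, i, j} →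
      T = {0, i} ∨ T = {0, j} := by
    intro T hT hmem hs
    obtain ⟨v, hv⟩ := Finset.card_eq_one.1 (by rw [Finset.card_erase_of_mem hmem, hT] :
      (T.erase 0).card = 1)
    have hv0 : v ∈ T.erase 0 := hv ▸ Finset.mem_singleton_self v
    have hT' : T = {0, v} := by rw [← hv, Finset.insert_erase hmem]
    have hv' := hs (Finset.mem_of_mem_erase hv0)
    simp only [Finset.mem_insert, Finset.mem_singleton, Finset.ne_of_mem_erase hv0,
      false_or] at hv'
    rcases hv' with rfl | rfl
    · exact Or.inl hT'
    · exact Or.inr hT'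
  set S : Finset (Finset (Fin n) × Finset (Fin n)) := Finset.univ.filter fun p ↦
    p = ({0}, {0, i, j}) ∨ (p.1 ∈ Q ∧ p.2 = μ p.1) ∨
      (p.1 ∈ P ∧ p.2 = p.1 ∧ 3 ≤ p.1.card ∧ p.1 ≠ {0, i, j} ∧ ∀ b ∈ Q, μ b ≠ p.1) with hS
  have memS : ∀ p, p ∈ S ↔ p = ({0}, {0, i, j}) ∨ (p.1 ∈ Q ∧ p.2 = μ p.1) ∨
      (p.1 ∈ P ∧ p.2 = p.1 ∧ 3 ≤ p.1.card ∧ p.1 ≠ {0, i, j} ∧ ∀ b ∈ Q, μ b ≠ p.1) := by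
    simp [hS]
  let own : Finset (Fin n) → Finset (Fin n) × Finset (Fin n) := fun T ↦
    if (0 : Fin n) ∈ T ∧ T ⊆ {0, i, j} then ({0}, {0, i, j})
    else if T ∈ Q then (T, μ T)
    else if h : ∃ b ∈ Q, μ b = T then (h.choose, T) else (T, T)
  have hown : ∀ p ∈ S, ∀ T, p.1 ⊆ T → T ⊆ p.2 → p = own T := by
    rintro ⟨u, v⟩ hp T hu hv
    rcases (memS _).1 hp with h | ⟨hq, h⟩ | ⟨-, h, hc, hne, hno⟩
    · obtain ⟨rfl, rfl⟩ := Prod.mk.inj h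
      exact (if_pos ⟨hu (Finset.mem_singleton_self 0), hv⟩).symm
    · dsimp only at hq h hu hv
      subst h
      obtain ⟨-, hc3, hs, hne⟩ := hμQ u hq
      have hc2 : u.card = 2 := hq.2.1
      have hTu := Finset.card_le_card hu
      have hTv := Finset.card_le_card hv
      rcases (by omega : T.card = 2 ∨ T.card = 3) with hT | hT
      · obtain rfl : u = T := Finset.eq_of_subset_of_card_le hu (by omega)
        have hnot : ¬ ((0 : Fin n) ∈ u ∧ u ⊆ {0, i, j}) := fun hc ↦
          (htwo u hT hc.1 hc.2).elim hq.2.2.1 hq.2.2.2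
        simp only [own, if_neg hnot, if_pos hq]
      · obtain rfl : T = μ u := Finset.eq_of_subset_of_card_le hv (by omega)
        have hnot : ¬ ((0 : Fin n) ∈ μ u ∧ μ u ⊆ {0, i, j}) := fun hc ↦
          hne (hbig _ hT.ge hc.2)
        have hnQ : μ u ∉ Q := fun hc ↦ by have := hc.2.1; omega
        have hex : ∃ b ∈ Q, μ b = μ u := ⟨u, hq, rfl⟩
        simp only [own, if_neg hnot, if_neg hnQ, dif_pos hex]
        rw [hinj hex.choose_spec.1 hq hex.choose_spec.2]
    · dsimp only at h hc hne hno hu hv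
      subst h
      obtain rfl : v = T := Finset.Subset.antisymm hu hv
      have hnot : ¬ ((0 : Fin n) ∈ v ∧ v ⊆ {0, i, j}) := fun h ↦ hne (hbig _ hc h.2)
      have hnQ : v ∉ Q := fun h ↦ by have := h.2.1; omega
      have hnex : ¬ ∃ b ∈ Q, μ b = v := fun ⟨b, hb, h⟩ ↦ hno b hb h
      simp only [own, if_neg hnot, if_neg hnQ, dif_neg hnex]
  refine ⟨⟨S, ?_, ?_, ?_, ?_⟩, ?_⟩
  · intro p hp
    rcases (memS _).1 hp with rfl | ⟨hq, h⟩ | ⟨-, h, -⟩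
    · simp
    · exact h ▸ (hμQ _ hq).2.2.1
    · exact h ▸ subset_rfl
  · intro p hp
    rcases (memS _).1 hp with rfl | ⟨hq, h⟩ | ⟨hp, h, -⟩
    · exact ⟨h0, hP⟩
    · exact ⟨hq.1, h ▸ (hμQ _ hq).1⟩
    · exact ⟨hp, h ▸ hp⟩
  · intro T hT
    by_cases hT0 : (0 : Fin n) ∈ T ∧ T ⊆ {0, i, j}
    · exact ⟨_, (memS _).2 (Or.inl rfl), by simpa using hT0.1, hT0.2⟩
    by_cases hTQ : T ∈ Q
    · exact ⟨(T, μ T), (memS _).2 (Or.inr (Or.inl ⟨hTQ, rfl⟩)), subset_rfl, (hμQ T hTQ).2.2.1⟩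
    by_cases hex : ∃ b ∈ Q, μ b = T
    · obtain ⟨b, hb, rfl⟩ := hex
      exact ⟨(b, μ b), (memS _).2 (Or.inr (Or.inl ⟨hb, rfl⟩)), (hμQ b hb).2.2.1, subset_rfl⟩
    refine ⟨(T, T), (memS _).2 (Or.inr (Or.inr ⟨hT, rfl, ?_, ?_, ?_⟩)), subset_rfl, subset_rfl⟩
    · have h2 := hcard T hT (by rintro rfl; simp at hT0)
      by_contra hlt
      refine hTQ ⟨hT, by dsimp only at hlt; omega, ?_, ?_⟩
      · rintro rfl
        exact hT0 ⟨by simp, by intro x; simp; tauto⟩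
      · rintro rfl
        exact hT0 ⟨by simp, by intro x; simp; tauto⟩
    · rintro rfl
      exact hT0 ⟨by simp, subset_rfl⟩
    · exact fun b hb h ↦ hex ⟨b, hb, h⟩
  · intro p hp q hq T h1 h2 h3 h4
    rw [hown p hp T h1 h2, hown q hq T h3 h4]
  · intro p hp
    rcases (memS _).1 hp with rfl | ⟨hq, h⟩ | ⟨-, h, hc, -⟩
    · exact h3.ge
    · exact h ▸ (hμQ _ hq).2.1.ge
    · exact h ▸ hc

/-- A partition whose intervals all end in degree at least `d` bounds the Stanley depth below. -/
theorem le_stanleyDepth {K : Type*} [Field K] {n d : ℕ} {I J : Ideal (MvPolynomial (Fin n) K)}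
    (pt : SqfPartition n (sqfPoset K n I J)) (hne : (sqfPoset K n I J).Nonempty)
    (h : ∀ p ∈ pt.intervals, d ≤ p.2.card) : d ≤ stanleyDepth K n I J := by
  have hint : ∀ pt : SqfPartition n (sqfPoset K n I J),
      {k | ∃ p ∈ pt.intervals, p.2.card = k}.Nonempty := by
    intro pt
    obtain ⟨T, hT⟩ := hne
    obtain ⟨p, hp, -⟩ := pt.covers T hT
    exact ⟨_, p, hp, rfl⟩
  have hd : d ≤ pt.sdepth := by
    obtain ⟨p, hp, hk⟩ := Nat.sInf_mem (hint pt)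
    exact (h p hp).trans hk.le
  refine hd.trans (le_csSup ⟨n, ?_⟩ ⟨pt, rfl⟩)
  rintro k ⟨pt', rfl⟩
  obtain ⟨p, hp, hk⟩ := Nat.sInf_mem (hint pt')
  exact hk.ge.trans (by simpa using p.2.card_le_univ)

/-- If `I/J` has depth at least three, `I` has no squarefree generators of degree one besides
`{0}` and `J` has none of degree at most one, then the squarefree part of the Koszul complex
is exact in degree two. -/
theorem cob_exact_of_two_lt_mdepth {n : ℕ} [NeZero n] {K : Type*} [Field K]
    {A G : Set (Finset (Fin n))}
    (hA : ∀ k : Fin n, k ≠ 0 → sqf K n {k} ∉ Ideal.span (sqf K n '' A))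
    (h3 : 2 < mdepth K n (Ideal.span (sqf K n '' A)) (Ideal.span (sqf K n '' G)))
    (f : Finset (Fin n) → K)
    (hf : ∀ T, ¬ (T ∈ sqfPoset K n (Ideal.span (sqf K n '' A)) (Ideal.span (sqf K n '' G)) ∧
      T.card = 2) → f T = 0)
    (hcob : ∀ T ∈ sqfPoset K n (Ideal.span (sqf K n '' A)) (Ideal.span (sqf K n '' G)),
      T.card = 3 → cob K n f T = 0) :
    (∀ e ∈ sqfPoset K n (Ideal.span (sqf K n '' A)) (Ideal.span (sqf K n '' G)),
      (0 : Fin n) ∉ e → f e = 0) ∧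
    ∀ a b : Fin n, a ≠ 0 → b ≠ 0 →
      {0, a} ∈ sqfPoset K n (Ideal.span (sqf K n '' A)) (Ideal.span (sqf K n '' G)) →
      {0, b} ∈ sqfPoset K n (Ideal.span (sqf K n '' A)) (Ideal.span (sqf K n '' G)) →
      f {0, a} = f {0, b} := by
  classical
  set I := Ideal.span (sqf K n '' A) with hI
  set J := Ideal.span (sqf K n '' G) with hJ
  have hup : ∀ T T' : Finset (Fin n), T ⊆ T' → sqf K n T ∈ I → sqf K n T' ∈ I :=
    fun T T' hs h ↦ I.mem_of_dvd (Finset.prod_dvd_prod_of_subset _ _ _ hs) h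
  have hsqf : ∀ i j : Fin n, i ≠ j → sqf K n {i, j} = X i * X j := fun i j h ↦ by
    rw [sqf, Finset.prod_pair h]
  have hfP : ∀ T, f T ≠ 0 → T ∈ sqfPoset K n I J := fun T h ↦ by
    by_contra hc
    exact h (hf T fun h' ↦ hc h'.1)
  let F : Fin n → Fin n → K := fun i j ↦ if i < j then f {i, j} else if j < i then -f {i, j} else 0
  have hFlt : ∀ i j, i < j → F i j = f {i, j} := fun i j h ↦ if_pos h
  have hFself : ∀ i, F i i = 0 := fun i ↦ by simp [F]
  have hFanti : ∀ i j, F i j = -F j i := by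
    intro i j
    rcases lt_trichotomy i j with h | rfl | h
    · simp [F, h, h.not_gt, Finset.pair_comm j i]
    · simp [F]
    · simp [F, h, h.not_gt, Finset.pair_comm j i]
  have hFne : ∀ i j, F i j ≠ 0 → i ≠ j ∧ {i, j} ∈ sqfPoset K n I J := by
    intro i j h
    refine ⟨fun hc ↦ h (hc ▸ hFself i), hfP _ fun hc ↦ h ?_⟩
    simp [F, hc]
  have hsorted : ∀ i j k, i < j → j < k →
      F j k - F i k + F i j = 0 ∨ X i * X j * X k ∈ J := by
    intro i j k hij hjk
    have hik := hij.trans hjk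
    have hni : i ∉ ({j, k} : Finset (Fin n)) := by simp [hij.ne, hik.ne]
    have hprod : sqf K n {i, j, k} = X i * X j * X k := by
      rw [sqf, Finset.prod_insert hni, Finset.prod_pair hjk.ne, mul_assoc]
    rw [hFlt _ _ hjk, hFlt _ _ hik, hFlt _ _ hij, ← cob_triple f hij hjk, ← hprod]
    by_cases hJT : sqf K n {i, j, k} ∈ J
    · exact Or.inr hJT
    left
    by_cases hIT : sqf K n {i, j, k} ∈ I
    · exact hcob _ ⟨hIT, hJT⟩
        (by rw [Finset.card_insert_of_notMem hni, Finset.card_pair hjk.ne])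
    · refine cob_eq_zero fun x _ ↦ ?_
      by_contra hne
      exact hIT (hup _ _ (Finset.erase_subset _ _) (hfP _ hne).1)
  have hswap₁ : ∀ i j k, (F j k - F i k + F i j = 0 ∨ X i * X j * X k ∈ J) →
      (F i k - F j k + F j i = 0 ∨ X j * X i * X k ∈ J) := by
    rintro i j k (h | h)
    · left
      rw [hFanti j i, ← neg_eq_zero, ← h]
      ring
    · right
      rwa [mul_comm (X j) (X i)]
  have hswap₂ : ∀ i j k, (F j k - F i k + F i j = 0 ∨ X i * X j * X k ∈ J) →
      (F k j - F i j + F i k = 0 ∨ X i * X k * X j ∈ J) := by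
    rintro i j k (h | h)
    · left
      rw [hFanti k j, ← neg_eq_zero, ← h]
      ring
    · right
      rwa [mul_right_comm]
  have hall : ∀ i j k, F j k - F i k + F i j = 0 ∨ X i * X j * X k ∈ J := by
    intro i j k
    rcases lt_trichotomy i j with hij | rfl | hij
    · rcases lt_trichotomy j k with hjk | rfl | hjk
      · exact hsorted i j k hij hjk
      · left; rw [hFself]; ring
      · rcases lt_trichotomy i k with hik | rfl | hik
        · exact hswap₂ _ _ _ (hsorted i k j hik hjk)
        · left; rw [hFself, hFanti]; ring
        · exact hswap₂ _ _ _ (hswap₁ _ _ _ (hsorted k i j hik hij))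
    · left; rw [hFself]; ring
    · rcases lt_trichotomy i k with hik | rfl | hik
      · exact hswap₁ _ _ _ (hsorted j i k hij hik)
      · left; rw [hFself, hFanti]; ring
      · rcases lt_trichotomy j k with hjk | rfl | hjk
        · exact hswap₁ _ _ _ (hswap₂ _ _ _ (hsorted j k i hjk hik))
        · left; rw [hFself]; ring
        · exact hswap₁ _ _ _ (hswap₂ _ _ _ (hswap₁ _ _ _ (hsorted k j i hjk hij)))
  obtain ⟨N, hN, hNJ⟩ := exists_koszul_primitive h3 (fun i j ↦ C (F i j) * (X i * X j))
    (by
      intro i j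
      by_cases h : F i j = 0
      · simp [h]
      · obtain ⟨hij, hP⟩ := hFne i j h
        exact I.mul_mem_left _ (hsqf i j hij ▸ hP.1))
    (by
      intro i j
      rw [hFanti i j, map_neg]
      ring)
    (by
      intro i j k
      have : X i * (C (F j k) * (X j * X k)) - X j * (C (F i k) * (X i * X k)) +
          X k * (C (F i j) * (X i * X j)) =
          (C (F j k - F i k + F i j) : MvPolynomial (Fin n) K) * (X i * X j * X k) := by
        rw [map_add, map_sub]
        ring
      rw [this]
      rcases hall i j k with h | h
      · simp [h]
      · exact J.mul_mem_left _ h)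
  have hkey : ∀ i k, i < k → {i, k} ∈ sqfPoset K n I J →
      f {i, k} = coeff (Finsupp.single k 1) (N k) - coeff (Finsupp.single i 1) (N i) := by
    intro i k hik hP
    have h := coeff_eq_zero_of_mem_span_sqf (hNJ i k) hP.2
    have h1 : coeff (Finsupp.single i 1 + Finsupp.single k 1)
        (X i * X k : MvPolynomial (Fin n) K) = 1 := by
      rw [coeff_X_mul, coeff_X, if_pos rfl]
    have h2 : coeff (Finsupp.single i 1 + Finsupp.single k 1) (X k * N i) =
        coeff (Finsupp.single i 1) (N i) := by
      rw [add_comm, coeff_X_mul]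
    rw [Finset.sum_pair hik.ne, coeff_sub, coeff_sub, coeff_C_mul, h1, coeff_X_mul, h2,
      mul_one, hFlt _ _ hik, sub_eq_zero] at h
    exact h
  have hNz : ∀ k, k ≠ 0 → coeff (Finsupp.single k 1) (N k) = 0 := by
    intro k hk
    simpa using coeff_eq_zero_of_mem_span_sqf (hN k) (hA k hk)
  constructor
  · intro e he h0
    by_cases hcard : e.card = 2
    · obtain ⟨x, y, hxy, rfl⟩ := Finset.card_eq_two.1 hcard
      simp only [Finset.mem_insert, Finset.mem_singleton, not_or] at h0
      rcases hxy.lt_or_gt with h | h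
      · rw [hkey x y h he, hNz x (Ne.symm h0.1), hNz y (Ne.symm h0.2), sub_zero]
      · rw [Finset.pair_comm] at he ⊢
        rw [hkey y x h he, hNz x (Ne.symm h0.1), hNz y (Ne.symm h0.2), sub_zero]
    · exact hf e fun h ↦ hcard h.2
  · intro a b ha hb haP hbP
    rw [hkey 0 a (Fin.pos_iff_ne_zero.2 ha) haP, hkey 0 b (Fin.pos_iff_ne_zero.2 hb) hbP,
      hNz a ha, hNz b hb]

/-- If `X 0 * X k ∈ J` for all `k ≠ 0` except possibly one `k = a`, then `I/J` has depth at most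
two. -/
theorem mdepth_le_two_of_forall_ne {n : ℕ} [NeZero n] {K : Type*} [Field K]
    {A G : Set (Finset (Fin n))}
    (hA : sqf K n ∅ ∉ Ideal.span (sqf K n '' A)) (h0 : X 0 ∈ Ideal.span (sqf K n '' A))
    (hG : sqf K n {0} ∉ Ideal.span (sqf K n '' G)) {a : Fin n} (ha : a ≠ 0)
    (hk : ∀ k : Fin n, k ≠ 0 → k ≠ a → X k * X 0 ∈ Ideal.span (sqf K n '' G)) :
    mdepth K n (Ideal.span (sqf K n '' A)) (Ideal.span (sqf K n '' G)) ≤ 2 := by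
  classical
  by_contra! h3
  set J := Ideal.span (sqf K n '' G) with hJ
  let u : Fin n → MvPolynomial (Fin n) K := fun i ↦ if i = 0 then 1 else 0
  let w : Fin n → MvPolynomial (Fin n) K := fun i ↦ if i = a then 1 else 0
  have hu : ∀ i, ¬ (i = 0 ∨ i = a) → u i = 0 ∧ w i = 0 ∧ X i * X 0 ∈ J := by
    intro i hi
    push Not at hi
    exact ⟨if_neg hi.1, if_neg hi.2, hk i hi.1 hi.2⟩
  obtain ⟨N, hN, hNJ⟩ := exists_koszul_primitive h3 (fun i j ↦ (u i * w j - u j * w i) * X 0)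
    (fun i j ↦ Ideal.mul_mem_left _ _ h0) (fun i j ↦ by ring) (by
      intro i j k
      have hexp : X i * ((u j * w k - u k * w j) * X 0) - X j * ((u i * w k - u k * w i) * X 0) +
          X k * ((u i * w j - u j * w i) * X 0) =
          (u j * w k - u k * w j) * (X i * X 0) - (u i * w k - u k * w i) * (X j * X 0) +
          (u i * w j - u j * w i) * (X k * X 0) := by ring
      rw [hexp]
      by_cases hi : i = 0 ∨ i = a
      · by_cases hj : j = 0 ∨ j = a
        · by_cases hl : k = 0 ∨ k = a
          · convert J.zero_mem using 1
            rcases hi with rfl | rfl <;> rcases hj with rfl | rfl <;>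
              rcases hl with rfl | rfl <;> ring
          · obtain ⟨h1, h2, h3⟩ := hu k hl
            simpa [h1, h2] using J.mul_mem_left _ h3
        · obtain ⟨h1, h2, h3⟩ := hu j hj
          simpa [h1, h2] using J.mul_mem_left _ h3
      · obtain ⟨h1, h2, h3⟩ := hu i hi
        simpa [h1, h2] using J.mul_mem_left _ h3)
  have h := coeff_eq_zero_of_mem_span_sqf (hNJ 0 a) hG
  have hc : coeff 0 (N a) = 0 := by
    simpa using coeff_eq_zero_of_mem_span_sqf (hN a) hA
  have h1 : coeff (Finsupp.single 0 1) (X 0 * N a) = coeff 0 (N a) := by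
    simpa using coeff_X_mul 0 (0 : Fin n) (N a)
  have h2 : coeff (Finsupp.single 0 1) (X a * N 0) = 0 := by
    rw [coeff_X_mul', if_neg]
    simpa [Finsupp.single_apply] using ha
  rw [Finset.sum_singleton, coeff_sub, coeff_sub, h1, h2, hc] at h
  simp [u, w, ha, ha.symm] at h

/-- **Proposition 1.9.** -/
theorem stmt1 (n : ℕ) [NeZero n] (K : Type*) [Field K]
    (I J : Ideal (MvPolynomial (Fin n) K))
    (E : Set (Finset (Fin n))) (hE : E.Nonempty)
    (hEdeg : ∀ T ∈ E, T.card = 2 ∧ (0 : Fin n) ∉ T)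
    (hI : I = Ideal.span ({X (0 : Fin n)} ∪ sqf K n '' E))
    (hJI : J < I)
    (hJ : ∃ G : Set (Finset (Fin n)), (∀ T ∈ G, 2 ≤ T.card) ∧
      J = Ideal.span (sqf K n '' G))
    (hsd : stanleyDepth K n I J = 2)
    (hout : ∀ T : Finset (Fin n), T.card = 2 → sqf K n T ∉ I →
      X (0 : Fin n) * sqf K n T ∈ J)
    (B C E' D : Set (Finset (Fin n)))
    (hB : B = degSet K n I J 2)
    (hC : C = degSet K n I J 3)
    (hE' : E' = {T ∈ E | insert (0 : Fin n) T ∈ C})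
    (hD : D = {T ∈ C | sqf K n T ∉ Ideal.span ({X (0 : Fin n)} ∪ sqf K n '' E')})
    (hcond : (E \ E').ncard ≤ D.ncard ∨
      (D.ncard < (E \ E').ncard ∧ B.ncard ≠ C.ncard + 1)) :
    mdepth K n I J ≤ 2 := by
  by_contra! h3
  classical
  obtain ⟨G, hGcard, rfl⟩ := hJ
  have hX : sqf K n {0} = X 0 := Finset.prod_singleton _ _
  have hI' : I = Ideal.span (sqf K n '' ({{0}} ∪ E)) := by
    rw [hI, Set.image_union, Set.image_singleton, hX]
  clear hI
  subst hI'
  set I := Ideal.span (sqf K n '' ({{0}} ∪ E)) with hI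
  set J := Ideal.span (sqf K n '' G) with hJ
  have memI : ∀ T, sqf K n T ∈ I ↔ (0 : Fin n) ∈ T ∨ ∃ e ∈ E, e ⊆ T := by
    intro T
    rw [hI, sqf_mem_span_iff]
    simp [or_and_right, exists_or]
  have upJ : ∀ T T' : Finset (Fin n), T ⊆ T' → sqf K n T ∈ J → sqf K n T' ∈ J :=
    fun T T' hs h ↦ J.mem_of_dvd (Finset.prod_dvd_prod_of_subset _ _ _ hs) h
  have h0J : sqf K n {0} ∉ J := by
    rw [hJ, sqf_mem_span_iff]
    rintro ⟨U, hU, hs⟩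
    have h1 := hGcard U hU
    have h2 := Finset.card_le_card hs
    rw [Finset.card_singleton] at h2
    omega
  have h0P : {0} ∈ sqfPoset K n I J := ⟨(memI _).2 (Or.inl (by simp)), h0J⟩
  have hsmall : ∀ T : Finset (Fin n), T.card < 2 → (0 : Fin n) ∉ T → sqf K n T ∉ I := by
    intro T hT h0 h
    obtain ⟨e, he, hs⟩ := ((memI T).1 h).resolve_left h0
    have h1 := Finset.card_le_card hs
    rw [(hEdeg e he).1] at h1
    omega
  have hcard : ∀ T ∈ sqfPoset K n I J, T ≠ {0} → 2 ≤ T.card := by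
    intro T hT hne
    by_contra! hlt
    by_cases h0 : (0 : Fin n) ∈ T
    · exact hne (Finset.eq_of_subset_of_card_le (Finset.singleton_subset_iff.2 h0)
        (by rw [Finset.card_singleton]; omega)).symm
    · exact hsmall T hlt h0 hT.1
  have hzero : ∀ T T', T' ∈ sqfPoset K n I J → T ⊆ T' → (0 : Fin n) ∈ T →
      T ∈ sqfPoset K n I J :=
    fun T T' hT' hs h0 ↦ ⟨(memI T).2 (Or.inl h0), fun hc ↦ hT'.2 (upJ _ _ hs hc)⟩
  have hlink : ∀ e : Finset (Fin n), e.card = 2 → (0 : Fin n) ∉ e →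
      insert 0 e ∈ sqfPoset K n I J → e ∈ sqfPoset K n I J := by
    intro e he h0 hP
    refine ⟨?_, fun hc ↦ hP.2 (upJ _ _ (Finset.subset_insert _ _) hc)⟩
    by_contra hc
    refine hP.2 ?_
    rw [sqf, Finset.prod_insert h0]
    exact hout e he hc
  have hex := cob_exact_of_two_lt_mdepth
    (fun k hk ↦ hsmall {k} (by simp) (by simpa using hk.symm)) h3
  have htwo : ∃ a b : Fin n, a ≠ 0 ∧ b ≠ 0 ∧ a ≠ b ∧ {0, a} ∈ sqfPoset K n I J ∧
      {0, b} ∈ sqfPoset K n I J := by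
    by_contra! hno
    obtain ⟨a, ha, hak⟩ : ∃ a : Fin n, a ≠ 0 ∧
        ∀ k, k ≠ 0 → k ≠ a → {0, k} ∉ sqfPoset K n I J := by
      by_cases hv : ∃ v : Fin n, v ≠ 0 ∧ {0, v} ∈ sqfPoset K n I J
      · obtain ⟨v, hv0, hv⟩ := hv
        exact ⟨v, hv0, fun k hk hkv ↦ hno v k hv0 hk hkv.symm hv⟩
      · push Not at hv
        obtain ⟨e, he⟩ := hE
        obtain ⟨hc, h0⟩ := hEdeg e he
        obtain ⟨a, ha⟩ : e.Nonempty := Finset.card_pos.1 (by omega)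
        exact ⟨a, fun h ↦ h0 (h ▸ ha), fun k hk _ ↦ hv k hk⟩
    refine h3.not_ge (mdepth_le_two_of_forall_ne (hsmall ∅ (by simp) (by simp)) (hX ▸ h0P.1)
      h0J ha fun k hk hka ↦ ?_)
    by_contra hc
    refine hak k hk hka ⟨(memI _).2 (Or.inl (by simp)), ?_⟩
    rwa [sqf, Finset.prod_pair hk.symm, mul_comm]
  obtain ⟨i, j, hi, hj, hij, hP, μ, hinj, hμ⟩ :=
    exists_matching_of_exact (sqfPoset K n I J) hzero hlink hex htwo
  obtain ⟨pt, hpt⟩ := exists_partition_of_matching _ h0P hcard hi hj hij hP μ hinj hμ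
  have := le_stanleyDepth pt ⟨_, h0P⟩ hpt
  omega
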